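/- arXiv:physics/0409108 — 4 statements merged into one kernel-verified Lean document; each statement's English description precedes it below -/
import Mathlib

section
/- Let v, p, q be points in three-dimensional Euclidean space with dist(v, p) = dist(v, q) = dl > 0, and suppose v, p, q are not collinear. Let β = ∠pvq ∈ (0, π) be the angle at v and let θ = π − β be the turning angle. Then there exists a point c such that: (i) the orthogonal projection of c onto the line through v and p is the midpoint of v and p; (ii) the orthogonal projection of c onto the line through v and q is the midpoint of v and q; and (iii) dist(c, midpoint(v,p)) = dist(c, midpoint(v,q)) = dl/(2·tan(θ/2)). Consequently, the circle of radius dl/(2·tan(θ/2)) centered at c is tangent to both edges vp and vq at their midpoints. -/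
open EuclideanGeometry Real

section

variable {V P : Type*} [NormedAddCommGroup V] [InnerProductSpace ℝ V] [MetricSpace P]
  [NormedAddTorsor V P]

/-- The point on the bisector of `∠ p v q` which, when `dist v p = dist v q`, projects to the
midpoints of the two sides. -/
noncomputable def arcCenter (v p q : P) : P :=
  (1 / (4 * Real.cos (∠ p v q / 2) ^ 2)) • ((p -ᵥ v) + (q -ᵥ v)) +ᵥ v

theorem arcCenter_comm (v p q : P) : arcCenter v p q = arcCenter v q p := by
  rw [arcCenter, arcCenter, EuclideanGeometry.angle_comm, add_comm (p -ᵥ v)]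

theorem arcCenter_vsub_midpoint (v p q : P) :
    arcCenter v p q -ᵥ midpoint ℝ v p =
      (1 / (4 * Real.cos (∠ p v q / 2) ^ 2)) • ((p -ᵥ v) + (q -ᵥ v)) -
        (1 / 2 : ℝ) • (p -ᵥ v) := by
  rw [arcCenter, vadd_vsub_assoc, left_vsub_midpoint, ← neg_vsub_eq_vsub_rev p v, smul_neg,
    ← sub_eq_add_neg, invOf_eq_inv, one_div 2]

theorem inner_vsub_vsub_of_dist_eq {v p q : P} {d : ℝ} (hp : dist v p = d) (hq : dist v q = d) :
    inner ℝ (p -ᵥ v) (q -ᵥ v) = d ^ 2 * (2 * Real.cos (∠ p v q / 2) ^ 2 - 1) := by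
  rw [← Real.cos_two_mul, mul_div_cancel₀ _ two_ne_zero, EuclideanGeometry.angle,
    ← InnerProductGeometry.cos_angle_mul_norm_mul_norm, ← dist_eq_norm_vsub V p v,
    ← dist_eq_norm_vsub V q v, dist_comm p, dist_comm q, hp, hq]
  ring

theorem inner_arcCenter_vsub_midpoint {v p q : P} {d : ℝ} (hp : dist v p = d) (hq : dist v q = d)
    (hcos : Real.cos (∠ p v q / 2) ≠ 0) :
    inner ℝ (p -ᵥ v) (arcCenter v p q -ᵥ midpoint ℝ v p) = 0 := by
  have hpp : ‖p -ᵥ v‖ = d := by rw [← dist_eq_norm_vsub, dist_comm, hp]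
  rw [arcCenter_vsub_midpoint, inner_sub_right, inner_smul_right, inner_smul_right,
    inner_add_right, inner_vsub_vsub_of_dist_eq hp hq, real_inner_self_eq_norm_sq, hpp]
  field_simp
  ring

theorem orthogonalProjection_arcCenter {v p q : P} {d : ℝ} (hp : dist v p = d)
    (hq : dist v q = d) (hcos : Real.cos (∠ p v q / 2) ≠ 0) :
    (EuclideanGeometry.orthogonalProjection (affineSpan ℝ {v, p}) (arcCenter v p q) : P) =
      midpoint ℝ v p := by
  rw [EuclideanGeometry.coe_orthogonalProjection_eq_iff_mem]
  refine ⟨AffineMap.lineMap_mem_affineSpan_pair _ _ _, ?_⟩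
  rw [direction_affineSpan, vectorSpan_pair_rev, Submodule.mem_orthogonal_singleton_iff_inner_right]
  exact inner_arcCenter_vsub_midpoint hp hq hcos

theorem dist_arcCenter_midpoint {v p q : P} {d : ℝ} (hp : dist v p = d) (hq : dist v q = d)
    (hcos : 0 < Real.cos (∠ p v q / 2)) :
    dist (arcCenter v p q) (midpoint ℝ v p) = d / (2 * Real.tan ((π - ∠ p v q) / 2)) := by
  have hd : 0 ≤ d := hp ▸ dist_nonneg
  have hpp : ‖p -ᵥ v‖ = d := by rw [← dist_eq_norm_vsub, dist_comm, hp]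
  have hqq : ‖q -ᵥ v‖ = d := by rw [← dist_eq_norm_vsub, dist_comm, hq]
  have hsin : 0 ≤ Real.sin (∠ p v q / 2) :=
    Real.sin_nonneg_of_nonneg_of_le_pi (by linarith [EuclideanGeometry.angle_nonneg p v q])
      (by linarith [EuclideanGeometry.angle_le_pi p v q, Real.pi_pos])
  have htan : d / (2 * Real.tan ((π - ∠ p v q) / 2)) =
      d / 2 * (Real.sin (∠ p v q / 2) / Real.cos (∠ p v q / 2)) := by
    rw [sub_div, Real.tan_pi_div_two_sub, Real.tan_eq_sin_div_cos, mul_comm, ← div_div]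
    simp [div_eq_mul_inv]
    ring
  rw [htan, dist_eq_norm_vsub V, ← sq_eq_sq₀ (norm_nonneg _) (by positivity),
    ← real_inner_self_eq_norm_sq, arcCenter_vsub_midpoint]
  simp only [inner_sub_left, inner_sub_right, inner_add_left, inner_add_right, inner_smul_left,
    inner_smul_right, real_inner_comm (p -ᵥ v) (q -ᵥ v), inner_vsub_vsub_of_dist_eq hp hq,
    real_inner_self_eq_norm_sq, hpp, hqq, conj_trivial]
  rw [mul_pow, div_pow (Real.sin _), Real.sin_sq]
  field_simp
  ring

end

/-- At a vertex `v` of an equilateral polygon with adjacent vertices `p, q` at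
distance `dl`, with angle `β = ∠ p v q` and turning angle `θ = π − β`, there is a
center `c` whose orthogonal projections onto the lines through `v, p` and through
`v, q` are the respective edge midpoints, with
`dist c (midpoint v p) = dist c (midpoint v q) = dl / (2 tan(θ/2))`:
the circle of that radius centered at `c` is tangent to both edges at their
midpoints. -/
theorem inscribed_arc_center_exists
    (v p q : EuclideanSpace ℝ (Fin 3)) (dl : ℝ) (hdl : 0 < dl)
    (hvp : dist v p = dl) (hvq : dist v q = dl)
    (hncol : ¬ Collinear ℝ ({v, p, q} : Set (EuclideanSpace ℝ (Fin 3))))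
    (β θ : ℝ) (hβ : β = ∠ p v q) (hθ : θ = Real.pi - β) :
    ∃ c : EuclideanSpace ℝ (Fin 3),
      (EuclideanGeometry.orthogonalProjection
          (affineSpan ℝ ({v, p} : Set (EuclideanSpace ℝ (Fin 3)))) c
        = midpoint ℝ v p) ∧
      (EuclideanGeometry.orthogonalProjection
          (affineSpan ℝ ({v, q} : Set (EuclideanSpace ℝ (Fin 3)))) c
        = midpoint ℝ v q) ∧
      dist c (midpoint ℝ v p) = dl / (2 * Real.tan (θ / 2)) ∧
      dist c (midpoint ℝ v q) = dl / (2 * Real.tan (θ / 2)) := by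
  subst hβ hθ
  have hπ : ∠ p v q ≠ π := fun h ↦ hncol <| by
    have := EuclideanGeometry.collinear_of_angle_eq_pi h
    rwa [Set.insert_comm] at this
  have hcos : 0 < Real.cos (∠ p v q / 2) := by
    apply Real.cos_pos_of_mem_Ioo
    constructor
    · linarith [EuclideanGeometry.angle_nonneg p v q, Real.pi_pos]
    · linarith [lt_of_le_of_ne (EuclideanGeometry.angle_le_pi p v q) hπ]
  have hcos' : 0 < Real.cos (∠ q v p / 2) := EuclideanGeometry.angle_comm p v q ▸ hcos
  refine ⟨arcCenter v p q, orthogonalProjection_arcCenter hvp hvq hcos.ne', ?_,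
    dist_arcCenter_midpoint hvp hvq hcos, ?_⟩
  · rw [arcCenter_comm]
    exact orthogonalProjection_arcCenter hvq hvp hcos'.ne'
  · rw [arcCenter_comm, EuclideanGeometry.angle_comm]
    exact dist_arcCenter_midpoint hvq hvp hcos'
end

section
/- Let a, b, v₁, v₂ be points in three-dimensional Euclidean space with a ≠ b, let R_s, R_c be real numbers with R_c ≥ 0 and dist(v₁, v₂) ≥ 2·R_s, and let u = (b − a)/‖b − a‖ be the unit vector from a to b. If a + t·u lies in the closed ball of radius R_s centered at v₁ for every t ∈ [0, R_c], and b − t·u lies in the closed ball of radius R_s centered at v₂ for every t ∈ [0, R_c], then dist(a, b) ≥ 2·R_c. -/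
/-- Two closed balls of radius `r` whose centres are at distance at least `2 * r` can only meet at
the midpoint of the centres. -/
theorem eq_midpoint_of_mem_closedBall_of_mem_closedBall {E : Type*} [NormedAddCommGroup E]
    [NormedSpace ℝ E] [StrictConvexSpace ℝ E] {x y z : E} {r : ℝ} (hxy : 2 * r ≤ dist x y)
    (hx : z ∈ Metric.closedBall x r) (hy : z ∈ Metric.closedBall y r) :
    z = midpoint ℝ x y := by
  rw [Metric.mem_closedBall'] at hx
  rw [Metric.mem_closedBall] at hy
  have htri := dist_triangle x z y
  exact eq_midpoint_of_dist_eq_half (by linarith) (by linarith)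

/-- If the segments of length `R_c` issued from `a` towards `b` and from `b`
towards `a` lie in the closed balls of radius `R_s` about `v₁` and `v₂`
respectively, and these beads are disjoint (`dist v₁ v₂ ≥ 2 R_s`), then
`dist a b ≥ 2 R_c`. -/
theorem dist_ge_of_segments_in_disjoint_balls
    (a b v₁ v₂ : EuclideanSpace ℝ (Fin 3)) (hab : a ≠ b)
    (Rs Rc : ℝ) (hRc : 0 ≤ Rc) (hsep : dist v₁ v₂ ≥ 2 * Rs)
    (u : EuclideanSpace ℝ (Fin 3)) (hu : u = ‖b - a‖⁻¹ • (b - a))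
    (ha : ∀ t ∈ Set.Icc (0 : ℝ) Rc, a + t • u ∈ Metric.closedBall v₁ Rs)
    (hb : ∀ t ∈ Set.Icc (0 : ℝ) Rc, b - t • u ∈ Metric.closedBall v₂ Rs) :
    dist a b ≥ 2 * Rc := by
  by_contra! hlt
  set d := dist a b with hd
  have hd_pos : 0 < d := dist_pos.mpr hab
  have hd_norm : ‖b - a‖ = d := by rw [hd, dist_comm, dist_eq_norm]
  have hb_eq : b = a + d • u := by
    rw [hu, hd_norm, smul_inv_smul₀ hd_pos.ne']
    abel
  have hu_ne : u ≠ 0 := by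
    rintro rfl
    exact hab (by simpa using hb_eq.symm)
  have hmid : ∀ t, 0 ≤ t → t ≤ Rc → t ≤ d → d - t ≤ Rc → a + t • u = midpoint ℝ v₁ v₂ := by
    intro t h0 hR htd hdR
    refine eq_midpoint_of_mem_closedBall_of_mem_closedBall hsep (ha t ⟨h0, hR⟩) ?_
    have hbt := hb (d - t) ⟨by linarith, hdR⟩
    rwa [hb_eq, show a + d • u - (d - t) • u = a + t • u by module] at hbt
  have hlt' : d / 2 < min Rc d := lt_min (by linarith) (by linarith)
  have hmin_left := min_le_left Rc d
  have hmin_right := min_le_right Rc d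
  have heq : a + (d / 2) • u = a + (min Rc d) • u :=
    (hmid _ (by linarith) (by linarith) (by linarith) (by linarith)).trans
      (hmid _ (by linarith) (by linarith) (by linarith) (by linarith)).symm
  exact hlt'.ne (smul_left_injective ℝ hu_ne (add_left_cancel heq))
end

section
/- For every dl with 0 < dl ≤ 1, setting A = arcsin(arcsin(dl/4)), the inscribed segment length strictly overestimates the true segment length: 4·A < 2·dl·A·√(A⁻² − 1)/√(4 − dl²). -/
theorem arcsin_mem_Ioo_zero_one {y : ℝ} (hy0 : 0 < y) (hy1 : y < 3 / 4) :
    Real.arcsin y ∈ Set.Ioo 0 1 := by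
  have hpi := Real.pi_gt_three
  have hsin : 3 / 4 < Real.sin 1 := by
    have := Real.sin_gt_sub_cube one_pos
    linarith
  refine ⟨Real.arcsin_pos.2 hy0, ?_⟩
  rw [Real.arcsin_lt_iff_lt_sin ⟨by linarith, by linarith⟩ ⟨by linarith, by linarith⟩]
  linarith

theorem arcsin_sub_cube_lt {y : ℝ} (hy0 : 0 < y) (hy1 : y < 3 / 4) :
    Real.arcsin y - Real.arcsin y ^ 3 / 4 < y := by
  have h0 := (arcsin_mem_Ioo_zero_one hy0 hy1).1
  have h := Real.sin_gt_sub_cube h0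
  rw [Real.sin_arcsin (by linarith) (by linarith)] at h
  linarith [pow_pos h0 3]

theorem le_arcsin_self {y : ℝ} (hy0 : 0 < y) (hy1 : y < 3 / 4) : y ≤ Real.arcsin y := by
  have h := Real.sin_le (arcsin_mem_Ioo_zero_one hy0 hy1).1.le
  rwa [Real.sin_arcsin (by linarith) (by linarith)] at h

/-- With `A = arcsin(arcsin(dl/4))`, the inscribed segment length strictly
overestimates the true segment length:
`4A < 2 dl A √(A⁻² − 1) / √(4 − dl²)` for `0 < dl ≤ 1`. -/
theorem inscribed_overestimates (dl : ℝ) (h0 : 0 < dl) (h1 : dl ≤ 1)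
    (A : ℝ) (hA : A = Real.arcsin (Real.arcsin (dl / 4))) :
    4 * A < 2 * dl * A * Real.sqrt ((A ^ 2)⁻¹ - 1) / Real.sqrt (4 - dl ^ 2) := by
  have hx0 : 0 < dl / 4 := by positivity
  have hx1 : dl / 4 < 3 / 4 := by linarith
  obtain ⟨hz0, hz1⟩ := arcsin_mem_Ioo_zero_one hx0 hx1
  have hzx := arcsin_sub_cube_lt hx0 hx1
  set z := Real.arcsin (dl / 4)
  have hz2 : z < 3 / 4 := by
    have : z ^ 3 ≤ z := pow_le_of_le_one hz0.le hz1.le (by norm_num)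
    linarith
  obtain ⟨hA0, hA1⟩ := arcsin_mem_Ioo_zero_one hz0 hz2
  have hAz := arcsin_sub_cube_lt hz0 hz2
  have hzA := le_arcsin_self hz0 hz2
  rw [← hA] at hA0 hA1 hAz hzA
  have hcube : z ^ 3 ≤ A ^ 3 := by gcongr
  have hA2 : A ^ 2 < 1 := by nlinarith
  have hlow : A * (1 - A ^ 2 / 2) < dl / 4 := by nlinarith
  have hsq : (A * (1 - A ^ 2 / 2)) ^ 2 < (dl / 4) ^ 2 :=
    pow_lt_pow_left₀ hlow (mul_nonneg hA0.le (by linarith)) two_ne_zero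
  have hpoly : 1 ≤ (1 - A ^ 2 / 2) ^ 2 * (1 + 3 * A ^ 2) := by
    have : 0 ≤ A ^ 2 * ((1 - A ^ 2) * (2 - 3 / 4 * A ^ 2)) :=
      mul_nonneg (sq_nonneg A) (mul_nonneg (by linarith) (by linarith))
    linarith
  have hkey : A ^ 2 * (16 - 3 * dl ^ 2) < dl ^ 2 := by
    have e1 := mul_lt_mul_of_pos_right hsq (by positivity : 0 < 1 + 3 * A ^ 2)
    have e2 := mul_le_mul_of_nonneg_left hpoly (sq_nonneg A)
    linarith
  have hd : 0 < 4 - dl ^ 2 := by nlinarith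
  have hroot : 2 * Real.sqrt (4 - dl ^ 2) < dl * Real.sqrt ((A ^ 2)⁻¹ - 1) := by
    have hA3 : 1 ≤ (A ^ 2)⁻¹ := (one_le_inv₀ (by positivity)).2 hA2.le
    refine lt_of_pow_lt_pow_left₀ 2 (by positivity) ?_
    rw [mul_pow, mul_pow, Real.sq_sqrt hd.le, Real.sq_sqrt (by linarith)]
    have : 16 - 3 * dl ^ 2 < dl ^ 2 * (A ^ 2)⁻¹ := by
      rw [← div_eq_mul_inv, lt_div_iff₀ (by positivity)]
      linarith
    linarith
  rw [lt_div_iff₀ (Real.sqrt_pos.2 hd)]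
  have := mul_lt_mul_of_pos_left hroot (by positivity : 0 < 2 * A)
  linarith
end

section
/- Setting A(dl) = arcsin(arcsin(dl/4)), both the ratio of the raw polygonal segment length to the true segment length and the ratio of the inscribed segment length to the true segment length tend to 1 as dl → 0⁺; that is, dl/(4·A(dl)) → 1 and (2·dl·A(dl)·√(A(dl)⁻² − 1)/√(4 − dl²))/(4·A(dl)) → 1 as dl tends to 0 from the right. -/
open Topology Filter

theorem hasDerivAt_arcsin_arcsin_div_four :
    HasDerivAt (fun x : ℝ => Real.arcsin (Real.arcsin (x / 4))) (1 / 4) 0 := by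
  have h_arcsin : HasDerivAt Real.arcsin 1 0 := by
    simpa using Real.hasDerivAt_arcsin (x := 0) (by norm_num) (by norm_num)
  have h_inner : HasDerivAt (fun x : ℝ => Real.arcsin (x / 4)) (1 * (1 / 4)) 0 :=
    HasDerivAt.comp (h₂ := Real.arcsin) (0 : ℝ) (by simpa using h_arcsin)
      ((hasDerivAt_id (0 : ℝ)).div_const 4)
  have h_comp : HasDerivAt (fun x : ℝ => Real.arcsin (Real.arcsin (x / 4))) (1 * (1 * (1 / 4))) 0 :=
    HasDerivAt.comp (h₂ := Real.arcsin) (0 : ℝ) (by simpa using h_arcsin) h_inner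
  rwa [one_mul, one_mul] at h_comp

theorem tendsto_div_four_mul_arcsin_arcsin :
    Tendsto (fun x : ℝ => x / (4 * Real.arcsin (Real.arcsin (x / 4)))) (𝓝[>] (0 : ℝ)) (𝓝 1) := by
  have h := (hasDerivAt_arcsin_arcsin_div_four.tendsto_slope.mono_left
    (nhdsGT_le_nhdsNE (0 : ℝ))).const_mul 4
  have h_inv := h.inv₀ (by norm_num)
  norm_num at h_inv
  refine h_inv.congr fun x => ?_
  simp [slope_def_field, div_eq_mul_inv]
  ring

/-- With `A(dl) = arcsin(arcsin(dl/4))`, both the ratio `dL_p/dL` of the raw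
polygonal segment length to the true segment length and the ratio `dL_c/dL` of
the inscribed segment length to the true segment length tend to `1` as
`dl → 0⁺`. -/
theorem segment_length_ratios_tendsto_one :
    Filter.Tendsto
        (fun dl : ℝ => dl / (4 * Real.arcsin (Real.arcsin (dl / 4))))
        (𝓝[>] (0 : ℝ)) (𝓝 1) ∧
      Filter.Tendsto
        (fun dl : ℝ =>
          (2 * dl * Real.arcsin (Real.arcsin (dl / 4))
              * Real.sqrt (((Real.arcsin (Real.arcsin (dl / 4))) ^ 2)⁻¹ - 1)
              / Real.sqrt (4 - dl ^ 2))
            / (4 * Real.arcsin (Real.arcsin (dl / 4))))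
        (𝓝[>] (0 : ℝ)) (𝓝 1) := by
  refine ⟨tendsto_div_four_mul_arcsin_arcsin, ?_⟩
  have h_sqrt : Tendsto (fun x : ℝ =>
      2 * √(1 - Real.arcsin (Real.arcsin (x / 4)) ^ 2) / √(4 - x ^ 2)) (𝓝[>] (0 : ℝ)) (𝓝 1) := by
    have h_four : √(4 : ℝ) = 2 := by
      rw [show (4 : ℝ) = 2 ^ 2 by norm_num, Real.sqrt_sq zero_le_two]
    have h_cont : ContinuousAt (fun x : ℝ =>
        2 * √(1 - Real.arcsin (Real.arcsin (x / 4)) ^ 2) / √(4 - x ^ 2)) 0 := by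
      refine ContinuousAt.div (by fun_prop) (by fun_prop) ?_
      simp
    simpa [ContinuousAt, h_four] using h_cont.tendsto.mono_left nhdsWithin_le_nhds
  have h_mul := tendsto_div_four_mul_arcsin_arcsin.mul h_sqrt
  rw [mul_one] at h_mul
  refine h_mul.congr' ?_
  filter_upwards [self_mem_nhdsWithin] with x hx
  have h_pos : 0 < Real.arcsin (Real.arcsin (x / 4)) :=
    Real.arcsin_pos.2 (Real.arcsin_pos.2 (div_pos hx zero_lt_four))
  set A := Real.arcsin (Real.arcsin (x / 4))
  have h_inscribed : √((A ^ 2)⁻¹ - 1) = √(1 - A ^ 2) / A := by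
    rw [show (A ^ 2)⁻¹ - 1 = (1 - A ^ 2) / A ^ 2 by field_simp,
      Real.sqrt_div' _ (sq_nonneg A), Real.sqrt_sq h_pos.le]
  rw [h_inscribed]
  field_simp
end
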